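/- (Almost smoothness.) For any two mean-square stabilizing policies K, K' ∈ 𝕂, writing ΔK_i = K_i − K'_i and Ψ_i = R_i + B_iᵀ E_i(P^K) B_i, the cost difference satisfies C(K') − C(K) = ∑_{i=1}^N ( −2 tr(𝐗^{K'}_i ΔK_iᵀ L^K_i) + tr(𝐗^{K'}_i ΔK_iᵀ Ψ_i ΔK_i) ). -/

import Mathlib

open Matrix Filter
open scoped Kronecker Topology

namespace MJLS

noncomputable section

attribute [local instance] Classical.propDecidable

/-- Closed-loop matrices `Γ i = A i - B i * K i`. -/
def Gam {d k N : ℕ} (A : Fin N → Matrix (Fin d) (Fin d) ℝ)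
    (B : Fin N → Matrix (Fin d) (Fin k) ℝ)
    (K : Fin N → Matrix (Fin k) (Fin d) ℝ) : Fin N → Matrix (Fin d) (Fin d) ℝ :=
  fun i => A i - B i * K i

/-- The operator `E_i(V) = ∑ j, p i j • V j`. -/
def opE {d N : ℕ} (Pr : Matrix (Fin N) (Fin N) ℝ)
    (V : Fin N → Matrix (Fin d) (Fin d) ℝ) : Fin N → Matrix (Fin d) (Fin d) ℝ :=
  fun i => ∑ j, Pr i j • V j

/-- The matrix `𝒜 = diag(Γᵀ ⊗ Γᵀ) (P ⊗ I)`. -/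
def calA {d N : ℕ} (Pr : Matrix (Fin N) (Fin N) ℝ)
    (Γ : Fin N → Matrix (Fin d) (Fin d) ℝ) :
    Matrix (Fin N × Fin d × Fin d) (Fin N × Fin d × Fin d) ℝ :=
  (Matrix.reindex (Equiv.prodComm (Fin d × Fin d) (Fin N))
      (Equiv.prodComm (Fin d × Fin d) (Fin N))
      (Matrix.blockDiagonal fun i => (Γ i)ᵀ ⊗ₖ (Γ i)ᵀ)) *
    (Pr ⊗ₖ (1 : Matrix (Fin d × Fin d) (Fin d × Fin d) ℝ))

/-- `K` is mean-square stabilizing: the spectral radius of `𝒜` is less than `1`. -/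
def MSS {d k N : ℕ} (Pr : Matrix (Fin N) (Fin N) ℝ)
    (A : Fin N → Matrix (Fin d) (Fin d) ℝ) (B : Fin N → Matrix (Fin d) (Fin k) ℝ)
    (K : Fin N → Matrix (Fin k) (Fin d) ℝ) : Prop :=
  spectralRadius ℂ ((calA Pr (Gam A B K)).map (algebraMap ℝ ℂ)) < 1

/-- `P` solves the coupled Lyapunov equations for the policy `K`. -/
def IsLyap {d k N : ℕ} (Pr : Matrix (Fin N) (Fin N) ℝ)
    (A : Fin N → Matrix (Fin d) (Fin d) ℝ) (B : Fin N → Matrix (Fin d) (Fin k) ℝ)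
    (Q : Fin N → Matrix (Fin d) (Fin d) ℝ) (R : Fin N → Matrix (Fin k) (Fin k) ℝ)
    (K : Fin N → Matrix (Fin k) (Fin d) ℝ)
    (P : Fin N → Matrix (Fin d) (Fin d) ℝ) : Prop :=
  ∀ i, P i = Q i + (K i)ᵀ * R i * K i + (Gam A B K i)ᵀ * opE Pr P i * Gam A B K i

/-- `P^K`, the (for mean-square stabilizing `K`, unique) solution of the coupled
Lyapunov equations. -/
def PK {d k N : ℕ} (Pr : Matrix (Fin N) (Fin N) ℝ)
    (A : Fin N → Matrix (Fin d) (Fin d) ℝ) (B : Fin N → Matrix (Fin d) (Fin k) ℝ)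
    (Q : Fin N → Matrix (Fin d) (Fin d) ℝ) (R : Fin N → Matrix (Fin k) (Fin k) ℝ)
    (K : Fin N → Matrix (Fin k) (Fin d) ℝ) : Fin N → Matrix (Fin d) (Fin d) ℝ :=
  if h : ∃ P, IsLyap Pr A B Q R K P then h.choose else 0

/-- The LQR cost `C(K) = ∑ i, π i * tr(P^K_i Sg)`. -/
def cost {d k N : ℕ} (Pr : Matrix (Fin N) (Fin N) ℝ)
    (A : Fin N → Matrix (Fin d) (Fin d) ℝ) (B : Fin N → Matrix (Fin d) (Fin k) ℝ)
    (Q : Fin N → Matrix (Fin d) (Fin d) ℝ) (R : Fin N → Matrix (Fin k) (Fin k) ℝ)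
    (piv : Fin N → ℝ) (Sg : Matrix (Fin d) (Fin d) ℝ)
    (K : Fin N → Matrix (Fin k) (Fin d) ℝ) : ℝ :=
  ∑ i, piv i * (PK Pr A B Q R K i * Sg).trace

/-- The operator `T_j(V) = ∑ i, p i j • (Γ i * V i * Γ iᵀ)`. -/
def opT {d N : ℕ} (Pr : Matrix (Fin N) (Fin N) ℝ)
    (Γ : Fin N → Matrix (Fin d) (Fin d) ℝ)
    (V : Fin N → Matrix (Fin d) (Fin d) ℝ) : Fin N → Matrix (Fin d) (Fin d) ℝ :=
  fun j => ∑ i, Pr i j • (Γ i * V i * (Γ i)ᵀ)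

/-- `𝐗^K = ∑_{t=0}^∞ T^t(X(0))` with `X_i(0) = π i • Sg`. -/
def XK {d N : ℕ} (Pr : Matrix (Fin N) (Fin N) ℝ) (piv : Fin N → ℝ)
    (Sg : Matrix (Fin d) (Fin d) ℝ) (Γ : Fin N → Matrix (Fin d) (Fin d) ℝ) :
    Fin N → Matrix (Fin d) (Fin d) ℝ :=
  ∑' t : ℕ, (opT Pr Γ)^[t] (fun i => piv i • Sg)

/-- `L^K_i = (R i + B iᵀ E_i(P^K) B i) K i - B iᵀ E_i(P^K) A i`. -/
def LK {d k N : ℕ} (Pr : Matrix (Fin N) (Fin N) ℝ)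
    (A : Fin N → Matrix (Fin d) (Fin d) ℝ) (B : Fin N → Matrix (Fin d) (Fin k) ℝ)
    (Q : Fin N → Matrix (Fin d) (Fin d) ℝ) (R : Fin N → Matrix (Fin k) (Fin k) ℝ)
    (K : Fin N → Matrix (Fin k) (Fin d) ℝ) : Fin N → Matrix (Fin k) (Fin d) ℝ :=
  fun i => (R i + (B i)ᵀ * opE Pr (PK Pr A B Q R K) i * B i) * K i
    - (B i)ᵀ * opE Pr (PK Pr A B Q R K) i * A i

/-- The operator `L_i(V) = Γ iᵀ E_i(V) Γ i`. -/
def opL {d N : ℕ} (Pr : Matrix (Fin N) (Fin N) ℝ)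
    (Γ : Fin N → Matrix (Fin d) (Fin d) ℝ)
    (V : Fin N → Matrix (Fin d) (Fin d) ℝ) : Fin N → Matrix (Fin d) (Fin d) ℝ :=
  fun i => (Γ i)ᵀ * opE Pr V i * Γ i

/-- `(P^K)'[E] = ∑_{t=0}^∞ L^t(Eᵀ L^K + (L^K)ᵀ E)`. -/
def PKd {d k N : ℕ} (Pr : Matrix (Fin N) (Fin N) ℝ)
    (Γ : Fin N → Matrix (Fin d) (Fin d) ℝ)
    (Lk E : Fin N → Matrix (Fin k) (Fin d) ℝ) : Fin N → Matrix (Fin d) (Fin d) ℝ :=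
  ∑' t : ℕ, (opL Pr Γ)^[t] (fun i => (E i)ᵀ * Lk i + (Lk i)ᵀ * E i)

/-- `‖V‖₂² = ∑ i, tr(V iᵀ V i)`. -/
def norm2sq {a b N : ℕ} (V : Fin N → Matrix (Fin a) (Fin b) ℝ) : ℝ :=
  ∑ i, ((V i)ᵀ * V i).trace

/-- The inner product `⟨V, S⟩ = ∑ i, tr(V iᵀ S i)`. -/
def ip {a b N : ℕ} (V S : Fin N → Matrix (Fin a) (Fin b) ℝ) : ℝ :=
  ∑ i, ((V i)ᵀ * S i).trace

/-- The spectral norm (maximal singular value) of a matrix. -/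
def specNorm {a b : ℕ} (M : Matrix (Fin a) (Fin b) ℝ) : ℝ :=
  ⨆ x : {x : EuclideanSpace ℝ (Fin b) // ‖x‖ ≤ 1}, ‖Matrix.toEuclideanLin M x.1‖

/-- The minimal singular value of a square matrix. -/
def sigmaMin {a : ℕ} (M : Matrix (Fin a) (Fin a) ℝ) : ℝ :=
  ⨅ x : {x : EuclideanSpace ℝ (Fin a) // ‖x‖ = 1}, ‖Matrix.toEuclideanLin M x.1‖

/-- `‖V‖_max = max_i ‖V i‖` (spectral norms). -/
def maxNorm {a b N : ℕ} (V : Fin N → Matrix (Fin a) (Fin b) ℝ) : ℝ :=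
  ⨆ i, specNorm (V i)

/-- `Λ_min(V) = min_i σ_min(V i)`. -/
def lamMin {a N : ℕ} (V : Fin N → Matrix (Fin a) (Fin a) ℝ) : ℝ :=
  ⨅ i, sigmaMin (V i)

/-- `μ = (min_i π i) · σ_min(Sg)`. -/
def mu {d N : ℕ} (piv : Fin N → ℝ) (Sg : Matrix (Fin d) (Fin d) ℝ) : ℝ :=
  (⨅ i, piv i) * sigmaMin Sg

/-- `ξ(α) = (1/Λ_min(Q))·((1 + ‖B‖²_max)·α/μ + ‖R‖_max) − 1`. -/
def xi {d k N : ℕ} (B : Fin N → Matrix (Fin d) (Fin k) ℝ)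
    (R : Fin N → Matrix (Fin k) (Fin k) ℝ) (Q : Fin N → Matrix (Fin d) (Fin d) ℝ)
    (piv : Fin N → ℝ) (Sg : Matrix (Fin d) (Fin d) ℝ) (α : ℝ) : ℝ :=
  (1 / lamMin Q) * ((1 + maxNorm B ^ 2) * α / mu piv Sg + maxNorm R) - 1

/-- The smoothness constant
`L(α) = 2·(‖R‖_max + ‖B‖²_max·(1 + 2ξ(α)/‖B‖_max)·α/μ)·α/Λ_min(Q)`. -/
def Lsm {d k N : ℕ} (B : Fin N → Matrix (Fin d) (Fin k) ℝ)
    (R : Fin N → Matrix (Fin k) (Fin k) ℝ) (Q : Fin N → Matrix (Fin d) (Fin d) ℝ)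
    (piv : Fin N → ℝ) (Sg : Matrix (Fin d) (Fin d) ℝ) (α : ℝ) : ℝ :=
  2 * (maxNorm R + maxNorm B ^ 2 * (1 + 2 * xi B R Q piv Sg α / maxNorm B)
      * α / mu piv Sg) * α / lamMin Q

end

section helpers

attribute [local instance] Matrix.linftyOpNormedRing Matrix.linftyOpNormedAlgebra

lemma entry_summable {n : Type*} [Fintype n] [DecidableEq n] (M : Matrix n n ℂ)
    (h : spectralRadius ℂ M < 1) (i j : n) : Summable fun t : ℕ => (M ^ t) i j := by
  have : CompleteSpace (Matrix n n ℂ) := inferInstanceAs (CompleteSpace (n → n → ℂ))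
  obtain ⟨r, hr1, hr2⟩ := ENNReal.lt_iff_exists_nnreal_btwn.1 h
  have hr2' : r < 1 := by exact_mod_cast hr2
  have ht := spectrum.pow_nnnorm_pow_one_div_tendsto_nhds_spectralRadius M
  have hev := ht.eventually (gt_mem_nhds hr1)
  have hs : Summable fun t : ℕ => (r : ℝ) ^ t :=
    summable_geometric_of_lt_one r.2 (by exact_mod_cast hr2')
  refine hs.of_norm_bounded_eventually_nat ?_
  filter_upwards [hev, eventually_gt_atTop 0] with t h1 h2
  have h3 : (‖M ^ t‖₊ : ENNReal) ≤ (r : ENNReal) ^ t := by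
    have := ENNReal.rpow_le_rpow h1.le (z := (t : ℝ)) (by positivity)
    rw [← ENNReal.rpow_mul, one_div, inv_mul_cancel₀ (by positivity)] at this
    simpa using this
  have h4 : ‖M ^ t‖₊ ≤ r ^ t := by exact_mod_cast h3
  have h5 : ‖(M ^ t) i j‖₊ ≤ ‖M ^ t‖₊ := by
    rw [Matrix.linfty_opNNNorm_def]
    refine le_trans ?_ (Finset.le_sup (f := fun i => ∑ j, ‖(M ^ t) i j‖₊) (Finset.mem_univ i))
    exact Finset.single_le_sum (f := fun j => ‖(M ^ t) i j‖₊) (fun _ _ => zero_le) (Finset.mem_univ j)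
  exact_mod_cast h5.trans h4

end helpers

lemma entry_summable_real {n : Type*} [Fintype n] [DecidableEq n] (M : Matrix n n ℝ)
    (h : spectralRadius ℂ (M.map (algebraMap ℝ ℂ)) < 1) (i j : n) :
    Summable fun t : ℕ => (M ^ t) i j := by
  have := entry_summable _ h i j
  have h2 : ∀ t : ℕ, (M.map (algebraMap ℝ ℂ) ^ t) i j = (((M ^ t) i j : ℝ) : ℂ) := by
    intro t
    rw [← Matrix.map_pow]; rfl
  simp only [h2] at this
  exact_mod_cast this

lemma isUnit_real {n : Type*} [Fintype n] [DecidableEq n] (M : Matrix n n ℝ)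
    (h : spectralRadius ℂ (M.map (algebraMap ℝ ℂ)) < 1) : IsUnit (1 - M).det := by
  rw [isUnit_iff_ne_zero]
  intro h0
  obtain ⟨v, hv, hv2⟩ := Matrix.exists_mulVec_eq_zero_iff.2 h0
  apply hv
  have h1 : M *ᵥ v = v := by
    rw [Matrix.sub_mulVec, Matrix.one_mulVec, sub_eq_zero] at hv2
    exact hv2.symm
  have h2 : ∀ t : ℕ, (M ^ t) *ᵥ v = v := by
    intro t
    induction t with
    | zero => simp
    | succ t ih => rw [pow_succ, ← Matrix.mulVec_mulVec, h1, ih]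
  have h3 : Tendsto (fun t : ℕ => M ^ t *ᵥ v) atTop (𝓝 0) := by
    rw [tendsto_pi_nhds]
    intro i
    simp only [Matrix.mulVec, dotProduct]
    have : Tendsto (fun t : ℕ => ∑ j, (M ^ t) i j * v j) atTop (𝓝 (∑ j, 0 * v j)) :=
      tendsto_finsetSum _ fun j _ =>
        ((entry_summable_real M h i j).tendsto_atTop_zero).mul_const _
    simpa using this
  simp only [h2] at h3
  exact tendsto_nhds_unique tendsto_const_nhds h3

def vec3 {d N : ℕ} (V : Fin N → Matrix (Fin d) (Fin d) ℝ) : Fin N × Fin d × Fin d → ℝ :=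
  fun x => V x.1 x.2.1 x.2.2

def unvec3 {d N : ℕ} (v : Fin N × Fin d × Fin d → ℝ) : Fin N → Matrix (Fin d) (Fin d) ℝ :=
  fun i => Matrix.of fun a b => v (i, a, b)

lemma calA_apply {d N : ℕ} (Pr : Matrix (Fin N) (Fin N) ℝ)
    (Γ : Fin N → Matrix (Fin d) (Fin d) ℝ) (i j : Fin N) (a b c e : Fin d) :
    calA Pr Γ (i, a, b) (j, c, e) = Γ i c a * Γ i e b * Pr i j := by
  unfold calA
  rw [Matrix.mul_apply, Finset.sum_eq_single (i, c, e)]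
  · simp [Matrix.blockDiagonal_apply, Matrix.kroneckerMap_apply]
  · rintro ⟨i', c', e'⟩ - hne
    by_cases hi : i = i'
    · subst hi
      have : ¬ ((c', e') = (c, e)) := fun h => hne (by rw [h])
      simp [Matrix.kroneckerMap_apply, Matrix.one_apply_ne this]
    · simp [Matrix.blockDiagonal_apply, hi]
  · simp

lemma calA_mulVec {d N : ℕ} (Pr : Matrix (Fin N) (Fin N) ℝ)
    (Γ : Fin N → Matrix (Fin d) (Fin d) ℝ) (V : Fin N → Matrix (Fin d) (Fin d) ℝ) :
    calA Pr Γ *ᵥ vec3 V = vec3 (opL Pr Γ V) := by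
  ext ⟨i, a, b⟩
  simp only [Matrix.mulVec, dotProduct, Fintype.sum_prod_type, calA_apply, vec3, opL, opE,
    Matrix.mul_apply, Matrix.sum_apply, Matrix.smul_apply, Matrix.transpose_apply, smul_eq_mul,
    Finset.mul_sum, Finset.sum_mul]
  rw [Finset.sum_comm]
  rw [Finset.sum_congr rfl fun _ _ => Finset.sum_comm]
  rw [Finset.sum_comm]
  refine Finset.sum_congr rfl fun _ _ => ?_
  rw [Finset.sum_comm]
  refine Finset.sum_congr rfl fun _ _ => Finset.sum_congr rfl fun _ _ => by ring

lemma calA_transpose_mulVec {d N : ℕ} (Pr : Matrix (Fin N) (Fin N) ℝ)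
    (Γ : Fin N → Matrix (Fin d) (Fin d) ℝ) (V : Fin N → Matrix (Fin d) (Fin d) ℝ) :
    (calA Pr Γ)ᵀ *ᵥ vec3 V = vec3 (opT Pr Γ V) := by
  ext ⟨i, a, b⟩
  simp only [Matrix.mulVec, dotProduct, Fintype.sum_prod_type, calA_apply, vec3, opT,
    Matrix.mul_apply, Matrix.sum_apply, Matrix.smul_apply, Matrix.transpose_apply, smul_eq_mul,
    Finset.mul_sum, Finset.sum_mul]
  refine Finset.sum_congr rfl fun _ _ => ?_
  rw [Finset.sum_comm]
  refine Finset.sum_congr rfl fun _ _ => Finset.sum_congr rfl fun _ _ => by ring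

lemma vec3_injective {d N : ℕ} : Function.Injective (vec3 (d := d) (N := N)) := by
  intro V W h
  ext i a b
  exact congrFun h (i, a, b)

lemma lyap_exists {d N : ℕ} (Pr : Matrix (Fin N) (Fin N) ℝ)
    (Γ : Fin N → Matrix (Fin d) (Fin d) ℝ)
    (h : spectralRadius ℂ ((calA Pr Γ).map (algebraMap ℝ ℂ)) < 1)
    (S : Fin N → Matrix (Fin d) (Fin d) ℝ) : ∃ P, ∀ i, P i = S i + opL Pr Γ P i := by
  have hu := isUnit_real _ h
  refine ⟨unvec3 ((1 - calA Pr Γ)⁻¹ *ᵥ vec3 S), ?_⟩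
  set P := unvec3 ((1 - calA Pr Γ)⁻¹ *ᵥ vec3 S) with hP
  have h1 : vec3 P = (1 - calA Pr Γ)⁻¹ *ᵥ vec3 S := rfl
  have h2 : (1 - calA Pr Γ) *ᵥ vec3 P = vec3 S := by
    rw [h1, Matrix.mulVec_mulVec, Matrix.mul_nonsing_inv _ hu, Matrix.one_mulVec]
  rw [Matrix.sub_mulVec, Matrix.one_mulVec, calA_mulVec, sub_eq_iff_eq_add] at h2
  exact congrFun (vec3_injective (a₂ := S + opL Pr Γ P) h2)

lemma lyap_unique {d N : ℕ} (Pr : Matrix (Fin N) (Fin N) ℝ)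
    (Γ : Fin N → Matrix (Fin d) (Fin d) ℝ)
    (h : spectralRadius ℂ ((calA Pr Γ).map (algebraMap ℝ ℂ)) < 1)
    (S P P' : Fin N → Matrix (Fin d) (Fin d) ℝ) (h1 : ∀ i, P i = S i + opL Pr Γ P i)
    (h2 : ∀ i, P' i = S i + opL Pr Γ P' i) : P = P' := by
  have hu := isUnit_real _ h
  have key : ∀ P, (∀ i, P i = S i + opL Pr Γ P i) → (1 - calA Pr Γ) *ᵥ vec3 P = vec3 S := by
    intro P hP
    rw [Matrix.sub_mulVec, Matrix.one_mulVec, calA_mulVec, sub_eq_iff_eq_add]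
    have : P = S + opL Pr Γ P := funext hP
    conv_lhs => rw [this]
    rfl
  apply vec3_injective
  have h3 := (key P h1).trans (key P' h2).symm
  exact Matrix.mulVec_injective_of_isUnit ((Matrix.isUnit_iff_isUnit_det _).2 hu) h3

lemma opT_iter {d N : ℕ} (Pr : Matrix (Fin N) (Fin N) ℝ)
    (Γ : Fin N → Matrix (Fin d) (Fin d) ℝ) (V : Fin N → Matrix (Fin d) (Fin d) ℝ) (t : ℕ) :
    vec3 ((opT Pr Γ)^[t] V) = ((calA Pr Γ)ᵀ ^ t) *ᵥ vec3 V := by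
  induction t with
  | zero => simp
  | succ t ih =>
    rw [Function.iterate_succ_apply', ← calA_transpose_mulVec, ih, Matrix.mulVec_mulVec, pow_succ']

lemma opT_summable {d N : ℕ} (Pr : Matrix (Fin N) (Fin N) ℝ)
    (Γ : Fin N → Matrix (Fin d) (Fin d) ℝ)
    (h : spectralRadius ℂ ((calA Pr Γ).map (algebraMap ℝ ℂ)) < 1)
    (V : Fin N → Matrix (Fin d) (Fin d) ℝ) : Summable fun t : ℕ => (opT Pr Γ)^[t] V := by
  rw [Pi.summable]; intro i
  refine Pi.summable.2 fun a => Pi.summable.2 fun b => ?_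
  have : ∀ t : ℕ, (opT Pr Γ)^[t] V i a b
      = ∑ y, ((calA Pr Γ) ^ t) y (i, a, b) * vec3 V y := by
    intro t
    have := congrFun (opT_iter Pr Γ V t) (i, a, b)
    rw [← Matrix.transpose_pow] at this
    exact this
  simp only [this]
  exact summable_sum fun y _ => (entry_summable_real _ h y (i, a, b)).mul_right _

lemma opT_continuous {d N : ℕ} (Pr : Matrix (Fin N) (Fin N) ℝ)
    (Γ : Fin N → Matrix (Fin d) (Fin d) ℝ) : Continuous (opT Pr Γ) := by
  unfold opT
  fun_prop

def opTHom {d N : ℕ} (Pr : Matrix (Fin N) (Fin N) ℝ)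
    (Γ : Fin N → Matrix (Fin d) (Fin d) ℝ) :
    (Fin N → Matrix (Fin d) (Fin d) ℝ) →+ (Fin N → Matrix (Fin d) (Fin d) ℝ) where
  toFun := opT Pr Γ
  map_zero' := by ext; simp [opT]
  map_add' V W := by
    funext j
    simp [opT, Matrix.mul_add, Matrix.add_mul, Finset.sum_add_distrib]

lemma XK_eq {d N : ℕ} (Pr : Matrix (Fin N) (Fin N) ℝ) (piv : Fin N → ℝ)
    (Sg : Matrix (Fin d) (Fin d) ℝ) (Γ : Fin N → Matrix (Fin d) (Fin d) ℝ)
    (h : spectralRadius ℂ ((calA Pr Γ).map (algebraMap ℝ ℂ)) < 1) :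
    XK Pr piv Sg Γ = (fun i => piv i • Sg) + opT Pr Γ (XK Pr piv Sg Γ) := by
  have hs := opT_summable Pr Γ h (fun i => piv i • Sg)
  have h1 : opT Pr Γ (XK Pr piv Sg Γ) = ∑' t : ℕ, opT Pr Γ ((opT Pr Γ)^[t] fun i => piv i • Sg) :=
    (hs.hasSum.map (opTHom Pr Γ) (opT_continuous Pr Γ)).tsum_eq.symm
  rw [h1]
  conv_lhs => rw [XK, hs.tsum_eq_zero_add]
  simp only [Function.iterate_succ_apply', Function.iterate_zero, id]

lemma XK_symm {d N : ℕ} (Pr : Matrix (Fin N) (Fin N) ℝ) (piv : Fin N → ℝ)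
    (Sg : Matrix (Fin d) (Fin d) ℝ) (hSg : Sgᵀ = Sg) (Γ : Fin N → Matrix (Fin d) (Fin d) ℝ)
    (h : spectralRadius ℂ ((calA Pr Γ).map (algebraMap ℝ ℂ)) < 1) (i : Fin N) :
    (XK Pr piv Sg Γ i)ᵀ = XK Pr piv Sg Γ i := by
  have hs := opT_summable Pr Γ h (fun i => piv i • Sg)
  have hit : ∀ (t : ℕ) (i : Fin N), ((opT Pr Γ)^[t] (fun i => piv i • Sg) i)ᵀ
      = (opT Pr Γ)^[t] (fun i => piv i • Sg) i := by
    intro t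
    induction t with
    | zero => intro i; simp [hSg]
    | succ t ih =>
      intro i
      rw [Function.iterate_succ_apply']
      simp [opT, Matrix.transpose_sum, Matrix.transpose_mul, ih, Matrix.mul_assoc]
  rw [XK, tsum_apply hs, Matrix.transpose_tsum]
  simp only [hit]

lemma opE_transpose {d N : ℕ} (Pr : Matrix (Fin N) (Fin N) ℝ)
    (V : Fin N → Matrix (Fin d) (Fin d) ℝ) (i : Fin N) :
    (opE Pr V i)ᵀ = opE Pr (fun j => (V j)ᵀ) i := by
  simp [opE, Matrix.transpose_sum]

lemma duality {d N : ℕ} (Pr : Matrix (Fin N) (Fin N) ℝ)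
    (Γ V W : Fin N → Matrix (Fin d) (Fin d) ℝ) :
    ∑ i, (V i * opT Pr Γ W i).trace = ∑ i, (opL Pr Γ V i * W i).trace := by
  simp only [opT, opL, opE, Finset.mul_sum, Finset.sum_mul, Matrix.trace_sum, Matrix.mul_smul,
    Matrix.smul_mul, Matrix.trace_smul]
  rw [Finset.sum_comm]
  refine Finset.sum_congr rfl fun i _ => Finset.sum_congr rfl fun j _ => ?_
  congr 1
  rw [← Matrix.mul_assoc, Matrix.trace_mul_comm]
  simp only [Matrix.mul_assoc]

lemma PK_isLyap {d k N : ℕ} (Pr : Matrix (Fin N) (Fin N) ℝ)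
    (A : Fin N → Matrix (Fin d) (Fin d) ℝ) (B : Fin N → Matrix (Fin d) (Fin k) ℝ)
    (Q : Fin N → Matrix (Fin d) (Fin d) ℝ) (R : Fin N → Matrix (Fin k) (Fin k) ℝ)
    (K : Fin N → Matrix (Fin k) (Fin d) ℝ) (hK : MSS Pr A B K) :
    IsLyap Pr A B Q R K (PK Pr A B Q R K) := by
  have hex : ∃ P, IsLyap Pr A B Q R K P :=
    lyap_exists Pr (Gam A B K) hK (fun i => Q i + (K i)ᵀ * R i * K i)
  rw [PK, dif_pos hex]
  exact hex.choose_spec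

lemma PK_symm {d k N : ℕ} (Pr : Matrix (Fin N) (Fin N) ℝ)
    (A : Fin N → Matrix (Fin d) (Fin d) ℝ) (B : Fin N → Matrix (Fin d) (Fin k) ℝ)
    (Q : Fin N → Matrix (Fin d) (Fin d) ℝ) (R : Fin N → Matrix (Fin k) (Fin k) ℝ)
    (hQ : ∀ i, (Q i)ᵀ = Q i) (hR : ∀ i, (R i)ᵀ = R i)
    (K : Fin N → Matrix (Fin k) (Fin d) ℝ) (hK : MSS Pr A B K) (i : Fin N) :
    (PK Pr A B Q R K i)ᵀ = PK Pr A B Q R K i := by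
  have hL := PK_isLyap Pr A B Q R K hK
  have := lyap_unique Pr (Gam A B K) hK (fun i => Q i + (K i)ᵀ * R i * K i)
    (fun i => (PK Pr A B Q R K i)ᵀ) (PK Pr A B Q R K) ?_ hL
  · exact congrFun this i
  · intro i
    show (PK Pr A B Q R K i)ᵀ = _
    conv_lhs => rw [hL i]
    simp [opL, ← opE_transpose, Matrix.transpose_mul, hQ, hR, Matrix.mul_assoc]

/-- the "almost smoothness" identity for the cost difference. -/
theorem almost_smoothness
    (d k N : ℕ) (hd : 0 < d) (hk : 0 < k) (hN : 0 < N)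
    (A : Fin N → Matrix (Fin d) (Fin d) ℝ) (B : Fin N → Matrix (Fin d) (Fin k) ℝ)
    (Pr : Matrix (Fin N) (Fin N) ℝ)
    (hPr : ∀ i j, 0 ≤ Pr i j) (hPrSum : ∀ i, ∑ j, Pr i j = 1)
    (piv : Fin N → ℝ) (hpiv : ∀ i, 0 < piv i) (hpivSum : ∑ i, piv i = 1)
    (Sg : Matrix (Fin d) (Fin d) ℝ) (hSg : Sg.PosDef)
    (Q : Fin N → Matrix (Fin d) (Fin d) ℝ) (hQ : ∀ i, (Q i).PosDef)
    (R : Fin N → Matrix (Fin k) (Fin k) ℝ) (hR : ∀ i, (R i).PosDef)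
    (K K' : Fin N → Matrix (Fin k) (Fin d) ℝ)
    (hK : MSS Pr A B K) (hK' : MSS Pr A B K') :
    cost Pr A B Q R piv Sg K' - cost Pr A B Q R piv Sg K
      = ∑ i, (-2 * (XK Pr piv Sg (Gam A B K') i * (K i - K' i)ᵀ * LK Pr A B Q R K i).trace
          + (XK Pr piv Sg (Gam A B K') i * (K i - K' i)ᵀ
              * (R i + (B i)ᵀ * opE Pr (PK Pr A B Q R K) i * B i) * (K i - K' i)).trace) := by
  have hSg' : Sgᵀ = Sg := by simpa [Matrix.IsHermitian] using hSg.isHermitian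
  have hQ' : ∀ i, (Q i)ᵀ = Q i := fun i => by simpa [Matrix.IsHermitian] using (hQ i).isHermitian
  have hR' : ∀ i, (R i)ᵀ = R i := fun i => by simpa [Matrix.IsHermitian] using (hR i).isHermitian
  have hP := PK_isLyap Pr A B Q R K hK
  have hP' := PK_isLyap Pr A B Q R K' hK'
  have hPs := PK_symm Pr A B Q R hQ' hR' K hK
  have hX := XK_eq Pr piv Sg (Gam A B K') hK'
  have hXs := XK_symm Pr piv Sg hSg' (Gam A B K') hK'
  unfold cost LK
  set P := PK Pr A B Q R K
  set P' := PK Pr A B Q R K'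
  set X := XK Pr piv Sg (Gam A B K')
  set Γ' := Gam A B K' with hΓ'
  have hEs : ∀ i, (opE Pr P i)ᵀ = opE Pr P i := by
    intro i; rw [opE_transpose]; simp only [hPs]
  -- cost through `X`
  have hcost : ∀ V : Fin N → Matrix (Fin d) (Fin d) ℝ,
      ∑ i, piv i * (V i * Sg).trace = ∑ i, ((V i - opL Pr Γ' V i) * X i).trace := by
    intro V
    have h1 : ∀ i, piv i * (V i * Sg).trace = (V i * X i).trace - (V i * opT Pr Γ' X i).trace := by
      intro i
      have h2 : piv i • Sg = X i - opT Pr Γ' X i := by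
        have := congrFun hX i
        rw [Pi.add_apply] at this
        exact eq_sub_of_add_eq this.symm
      rw [← Matrix.trace_sub, ← Matrix.mul_sub, ← h2, Matrix.mul_smul, Matrix.trace_smul,
        smul_eq_mul]
    simp only [h1, Matrix.sub_mul, Matrix.trace_sub, Finset.sum_sub_distrib, duality]
  rw [hcost, hcost, ← Finset.sum_sub_distrib]
  refine Finset.sum_congr rfl fun i _ => ?_
  rw [← Matrix.trace_sub, ← Matrix.sub_mul]
  have e1 : P' i - opL Pr Γ' P' i = Q i + (K' i)ᵀ * R i * K' i := by
    rw [sub_eq_iff_eq_add]; exact hP' i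
  rw [e1, hP i]
  simp only [opL, hΓ', Gam]
  have hEi := hEs i
  have hRi := hR' i
  have hXi := hXs i
  generalize opE Pr P i = E at *
  generalize X i = Y at *
  obtain ⟨D, hD⟩ : ∃ D, D = K i - K' i := ⟨_, rfl⟩
  have hK2 : K' i = K i - D := by rw [hD]; abel
  rw [← hD, hK2]
  generalize K i = k0 at *
  generalize B i = b at *
  generalize A i = a at *
  generalize R i = r at *
  generalize Q i = q at *
  set L := (r + bᵀ * E * b) * k0 - bᵀ * E * a with hL
  have hLt : Lᵀ = k0ᵀ * (r + bᵀ * E * b) - aᵀ * E * b := by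
    simp [hL, Matrix.transpose_mul, hEi, hRi, Matrix.mul_assoc]
  have hG : q + (k0 - D)ᵀ * r * (k0 - D) - (q + k0ᵀ * r * k0 + (a - b * k0)ᵀ * E * (a - b * k0)
      - (a - b * (k0 - D))ᵀ * E * (a - b * (k0 - D)))
      = -(Dᵀ * L) - Lᵀ * D + Dᵀ * (r + bᵀ * E * b) * D := by
    rw [hLt, hL]
    simp only [Matrix.transpose_sub, Matrix.transpose_mul, Matrix.mul_sub, Matrix.sub_mul,
      Matrix.mul_add, Matrix.add_mul, Matrix.mul_assoc]
    abel
  rw [hG]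
  have t1 : (Lᵀ * D * Y).trace = (Y * Dᵀ * L).trace := by
    rw [← Matrix.trace_transpose]
    simp only [Matrix.transpose_mul, Matrix.transpose_transpose, hXi, Matrix.mul_assoc]
  have t2 : (Dᵀ * L * Y).trace = (Y * Dᵀ * L).trace := by
    rw [Matrix.trace_mul_comm, Matrix.mul_assoc]
  have t3 : (Dᵀ * (r + bᵀ * E * b) * D * Y).trace = (Y * Dᵀ * (r + bᵀ * E * b) * D).trace := by
    rw [Matrix.trace_mul_comm]; simp only [Matrix.mul_assoc]
  rw [Matrix.add_mul, Matrix.sub_mul, Matrix.neg_mul, Matrix.trace_add, Matrix.trace_sub,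
    Matrix.trace_neg, t1, t2, t3]
  ring

end MJLS
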